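/- If H is a 3-uniform hypergraph on n vertices containing no linear cycle and not containing K_5^3 as a subhypergraph, then the independence number of H satisfies α(H) ≥ ⌈n/2⌉. -/

import Mathlib

/-- A linear cycle of length `k ≥ 3` in a 3-uniform hypergraph with edge set `E`:
an alternating cyclic sequence of distinct vertices `v i` and distinct hyperedges `h i`
with `h i ∩ h (i+1) = {v (i+1)}` and non-consecutive hyperedges disjoint. -/
def IsLinearCycle {V : Type*} [DecidableEq V] (E : Finset (Finset V)) (k : ℕ)
    (v : ZMod k → V) (h : ZMod k → Finset V) : Prop :=
  3 ≤ k ∧ Function.Injective v ∧ Function.Injective h ∧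
    (∀ i, h i ∈ E) ∧ (∀ i, h i ∩ h (i + 1) = {v (i + 1)}) ∧
    (∀ i j, i ≠ j → i + 1 ≠ j → j + 1 ≠ i → h i ∩ h j = ∅)

/-- `E` contains a linear cycle. -/
def HasLinearCycle {V : Type*} [DecidableEq V] (E : Finset (Finset V)) : Prop :=
  ∃ (k : ℕ) (v : ZMod k → V) (h : ZMod k → Finset V), IsLinearCycle E k v h

/-- The degree of a vertex: the number of hyperedges containing it. -/
def hDegree {V : Type*} [DecidableEq V] (E : Finset (Finset V)) (v : V) : ℕ :=
  (E.filter (fun e => v ∈ e)).card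

/-- The support of a vertex `v` in a hyperedge `h`: the pairs of `h` that form a
hyperedge together with `v`. -/
def hSupport {V : Type*} [DecidableEq V] (E : Finset (Finset V)) (h : Finset V) (v : V) :
    Finset (Finset V) :=
  (h.powersetCard 2).filter (fun p => insert v p ∈ E)

/-- A pair of vertices is thick if at least two hyperedges contain it. -/
def ThickPair {V : Type*} [DecidableEq V] (E : Finset (Finset V)) (a b : V) : Prop :=
  2 ≤ (E.filter (fun e => a ∈ e ∧ b ∈ e)).card

/-- A hyperedge is thick if each of its pairs is contained in at least two hyperedges. -/
def ThickEdge {V : Type*} [DecidableEq V] (E : Finset (Finset V)) (h : Finset V) : Prop :=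
  ∀ p ∈ h.powersetCard 2, 2 ≤ (E.filter (fun e => p ⊆ e)).card

/-- `v ∉ h` is strongly associated to the hyperedge `h` if at least two of the 3-sets
formed by `v` and a pair of `h` are hyperedges. -/
def StronglyAssoc {V : Type*} [DecidableEq V] (E : Finset (Finset V)) (h : Finset V) (v : V) :
    Prop :=
  v ∉ h ∧ 2 ≤ (hSupport E h v).card

/-- A linear path of length `k` (given by its sequence of hyperedges): consecutive
hyperedges meet in exactly one vertex, non-consecutive ones are disjoint. -/
def IsLinearPath {V : Type*} [DecidableEq V] (E : Finset (Finset V)) (k : ℕ)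
    (h : Fin k → Finset V) : Prop :=
  Function.Injective h ∧ (∀ i, h i ∈ E) ∧
    (∀ i j : Fin k, (i : ℕ) + 1 = (j : ℕ) → (h i ∩ h j).card = 1) ∧
    (∀ i j : Fin k, (i : ℕ) + 2 ≤ (j : ℕ) → h i ∩ h j = ∅)

/-- A linear tree with vertex set `S` and edge set `T`: built from a single vertex by
repeatedly adding hyperedges meeting the current vertex set in exactly one vertex. -/
inductive IsLinearTree {V : Type*} [DecidableEq V] : Finset V → Finset (Finset V) → Prop
  | single (v : V) : IsLinearTree {v} ∅
  | extend {S : Finset V} {T : Finset (Finset V)} (e : Finset V) :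
      IsLinearTree S T → e.card = 3 → (e ∩ S).card = 1 → IsLinearTree (S ∪ e) (insert e T)

/-- The triple `a, b, c` is a hyperedge. -/
def HR {V : Type*} [DecidableEq V] (E : Finset (Finset V)) (a b c : V) : Prop :=
  ({a, b, c} : Finset V) ∈ E

/-- Every vertex `v ≠ y` of every hyperedge `e` is the intersection of `e` with some
other hyperedge. -/
def HGad {V : Type*} [DecidableEq V] (E : Finset (Finset V)) (y : V) : Prop :=
  ∀ e ∈ E, ∀ v ∈ e, v ≠ y → ∃ f ∈ E, f ∩ e = {v}

/-- Linear path from `x` to `y` with vertex set `U`. -/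
inductive LP {V : Type*} [DecidableEq V] (E : Finset (Finset V)) : V → V → Finset V → Prop
  | nil (x : V) : LP E x x {x}
  | cons (x z x' y : V) (U : Finset V) : HR E x z x' → x ∉ U → z ∉ U → x ≠ z →
      LP E x' y U → LP E x y (insert x (insert z U))

section helpers

variable {V : Type*} [DecidableEq V] {E : Finset (Finset V)}

lemma HR.rot {a b c : V} (h : HR E a b c) : HR E b c a := by
  unfold HR at *
  convert h using 1
  ext; simp; tauto

lemma HR.swap {a b c : V} (h : HR E a b c) : HR E b a c := by
  unfold HR at *
  convert h using 1
  ext; simp; tauto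

lemma HR.swap' {a b c : V} (h : HR E a b c) : HR E a c b := by
  unfold HR at *
  convert h using 1
  ext; simp; tauto

lemma HR.ne (h3 : ∀ e ∈ E, e.card = 3) {a b c : V} (h : HR E a b c) :
    a ≠ b ∧ a ≠ c ∧ b ≠ c := by
  have := h3 _ h
  refine ⟨?_, ?_, ?_⟩
  · rintro rfl
    have h2 := Finset.card_le_two (a := a) (b := c)
    simp at this
    omega
  · rintro rfl
    have h2 := Finset.card_le_two (a := b) (b := a)
    simp at this
    omega
  · rintro rfl
    have h2 := Finset.card_le_two (a := a) (b := b)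
    simp at this
    omega

lemma exists_HR (h3 : ∀ e ∈ E, e.card = 3) {e : Finset V} (he : e ∈ E) {v : V} (hv : v ∈ e) :
    ∃ s t, e = {v, s, t} := by
  have h2 : (e.erase v).card = 2 := by
    rw [Finset.card_erase_of_mem hv, h3 e he]
  obtain ⟨s, t, _, hst⟩ := Finset.card_eq_two.mp h2
  exact ⟨s, t, by rw [← hst, Finset.insert_erase hv]⟩

/-- Relational form of `HGad`. -/
lemma HGad.ex (h3 : ∀ e ∈ E, e.card = 3) {y : V} (hg : HGad E y) {a b c : V}
    (h : HR E a b c) (ha : a ≠ y) :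
    ∃ s t, HR E a s t ∧ s ≠ b ∧ s ≠ c ∧ t ≠ b ∧ t ≠ c := by
  obtain ⟨f, hf, hfe⟩ := hg _ h a (by simp) ha
  have haf : a ∈ f := by
    have : a ∈ f ∩ {a, b, c} := by rw [hfe]; simp
    exact (Finset.mem_inter.mp this).1
  obtain ⟨s, t, rfl⟩ := exists_HR h3 hf haf
  have hf' : HR E a s t := hf
  have n1 := hf'.ne h3
  have n2 := h.ne h3
  have key : ∀ x, x ∈ ({a, s, t} : Finset V) → x ∈ ({a, b, c} : Finset V) → x = a := by
    intro x h1 h2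
    have : x ∈ ({a, s, t} : Finset V) ∩ {a, b, c} := Finset.mem_inter.mpr ⟨h1, h2⟩
    rw [hfe] at this
    simpa using this
  refine ⟨s, t, hf, ?_, ?_, ?_, ?_⟩
  · rintro rfl
    exact n1.1 (key s (by simp) (by simp)).symm
  · rintro rfl
    exact n1.1 (key s (by simp) (by simp)).symm
  · rintro rfl
    exact n1.2.1 (key t (by simp) (by simp)).symm
  · rintro rfl
    exact n1.2.1 (key t (by simp) (by simp)).symm

lemma LP.left_mem {x y : V} {U : Finset V} (h : LP E x y U) : x ∈ U := by
  cases h <;> simp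

lemma LP.right_mem {x y : V} {U : Finset V} (h : LP E x y U) : y ∈ U := by
  induction h with
  | nil x => simp
  | cons x z x' y U _ _ _ _ _ ih => simp [ih]

lemma LP.single {x z y : V} (h3 : ∀ e ∈ E, e.card = 3) (h : HR E x z y) :
    LP E x y {x, z, y} := by
  have n := h.ne h3
  exact LP.cons x z y y {y} h (by simpa using n.2.1) (by simpa using n.2.2) n.1 (LP.nil y)

lemma LP.append {x y w : V} {U W : Finset V} (h : LP E x y U) (h' : LP E y w W)
    (hd : ∀ u ∈ U, u ∈ W → u = y) : LP E x w (U ∪ W) := by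
  induction h with
  | nil x =>
    have : ({x} : Finset V) ∪ W = W := by
      have := h'.left_mem
      ext u; simp; rintro rfl; exact this
    rw [this]; exact h'
  | cons x z x' y U hr hx hz hxz hp ih =>
    have hyU := hp.right_mem
    have h1 := ih h' (fun u hu => hd u (by simp [hu]))
    rw [Finset.insert_union, Finset.insert_union]
    refine LP.cons x z x' w _ hr ?_ ?_ hxz h1
    · intro hm
      rcases Finset.mem_union.mp hm with hm | hm
      · exact hx hm
      · exact hx ((hd x (by simp) hm) ▸ hyU)
    · intro hm
      rcases Finset.mem_union.mp hm with hm | hm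
      · exact hz hm
      · exact hz ((hd z (by simp) hm) ▸ hyU)

lemma LP.reverse (h3 : ∀ e ∈ E, e.card = 3) {x y : V} {U : Finset V} (h : LP E x y U) :
    LP E y x U := by
  induction h with
  | nil x => exact LP.nil x
  | cons x z x' y U hr hx hz hxz hp ih =>
    have h1 := ih.append (LP.single h3 hr.rot.swap) (by
      intro u hu hu'
      simp at hu'
      rcases hu' with rfl | rfl | rfl
      · rfl
      · exact absurd hu hz
      · exact absurd hu hx)
    have : insert x (insert z U) = U ∪ {x', z, x} := by
      have := hp.left_mem
      grind
    rw [this]; exact h1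

/-- A path with an extra edge in front. -/
lemma LP.front {x z x' y : V} {U : Finset V} (h3 : ∀ e ∈ E, e.card = 3)
    (hr : HR E x z x') (hx : x ∉ U) (hz : z ∉ U)
    (h : LP E x' y U) : LP E x y (insert x (insert z U)) :=
  LP.cons x z x' y U hr hx hz (hr.ne h3).1 h

/-- Labels of a path. -/
lemma LP.labels {x y : V} {U : Finset V} (h : LP E x y U) :
    ∃ (m : ℕ) (w z : ℕ → V), w 0 = x ∧ w m = y ∧ U.card = 2 * m + 1 ∧
      (∀ i < m, HR E (w i) (z i) (w (i + 1))) ∧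
      (∀ i ≤ m, w i ∈ U) ∧ (∀ i < m, z i ∈ U) ∧
      (∀ i ≤ m, ∀ j ≤ m, w i = w j → i = j) ∧
      (∀ i < m, ∀ j < m, z i = z j → i = j) ∧
      (∀ i ≤ m, ∀ j < m, w i ≠ z j) := by
  induction h with
  | nil x =>
    refine ⟨0, fun _ => x, fun _ => x, rfl, rfl, by simp, ?_, ?_, ?_, ?_, ?_, ?_⟩ <;> simp
  | cons x z x' y U hr hx hz hxz hp ih =>
    obtain ⟨m, w, zz, h0, hm, hc, he, hwU, hzU, hw, hzz, hwz⟩ := ih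
    refine ⟨m + 1, fun i => Nat.casesOn i x w, fun i => Nat.casesOn i z zz, rfl, hm, ?_, ?_, ?_,
      ?_, ?_, ?_, ?_⟩
    · rw [Finset.card_insert_of_notMem (by simp [hx, hxz]), Finset.card_insert_of_notMem hz, hc]
      ring
    · rintro (_ | i) hi
      · simpa [h0] using hr
      · exact he i (by omega)
    · rintro (_ | i) hi
      · simp
      · have := hwU i (by omega)
        simp [this]
    · rintro (_ | i) hi
      · simp
      · have := hzU i (by omega)
        simp [this]
    · rintro (_ | i) hi (_ | j) hj hij
      · rfl
      · exact absurd (hwU j (by omega)) (by simp at hij; rwa [← hij])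
      · exact absurd (hwU i (by omega)) (by simp at hij; rwa [hij])
      · simp at hij
        have := hw i (by omega) j (by omega) hij
        omega
    · rintro (_ | i) hi (_ | j) hj hij
      · rfl
      · exact absurd (hzU j (by omega)) (by simp at hij; rwa [← hij])
      · exact absurd (hzU i (by omega)) (by simp at hij; rwa [hij])
      · simp at hij
        have := hzz i (by omega) j (by omega) hij
        omega
    · rintro (_ | i) hi (_ | j) hj hij
      · exact hxz hij
      · exact absurd (hzU j (by omega)) (by simp at hij; rwa [← hij])
      · exact absurd (hwU i (by omega)) (by simp at hij; rwa [hij])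
      · exact hwz i (by omega) j (by omega) hij

lemma cycle_of_labels {k : ℕ} (hk : 3 ≤ k) (w z : ZMod k → V)
    (hw : Function.Injective w) (hz : Function.Injective z) (hwz : ∀ i j, w i ≠ z j)
    (he : ∀ i, HR E (w i) (z i) (w (i + 1))) : HasLinearCycle E := by
  have : Fact (1 < k) := ⟨by omega⟩
  have h1 : (1 : ZMod k) ≠ 0 := one_ne_zero
  have h2 : (1 + 1 : ZMod k) ≠ 0 := by
    intro h
    have : ((2 : ℕ) : ZMod k) = 0 := by push_cast; rw [← h]; norm_num
    rw [ZMod.natCast_eq_zero_iff] at this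
    have := Nat.le_of_dvd (by norm_num) this
    omega
  have n1 : ∀ i : ZMod k, i ≠ i + 1 := fun i h => h1 (by simp at h)
  have n2 : ∀ i : ZMod k, i ≠ i + 1 + 1 := fun i h => h2 (by
    rw [add_assoc] at h; simpa using h)
  refine ⟨k, w, fun i => {w i, z i, w (i + 1)}, hk, hw, ?_, he, ?_, ?_⟩
  · intro i j hij
    have : z i ∈ ({w j, z j, w (j + 1)} : Finset V) := by
      rw [← show ({w i, z i, w (i + 1)} : Finset V) = {w j, z j, w (j + 1)} from hij]; simp
    simp at this
    rcases this with h | h | h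
    · exact absurd h.symm (hwz _ _)
    · exact hz h
    · exact absurd h.symm (hwz _ _)
  · intro i
    ext u
    simp only [Finset.mem_inter, Finset.mem_insert, Finset.mem_singleton]
    constructor
    · rintro ⟨h | h | h, h'⟩
      · subst h
        rcases h' with h | h | h
        · exact h
        · exact absurd h (hwz _ _)
        · exact absurd (hw h) (n2 i)
      · subst h
        rcases h' with h | h | h
        · exact h
        · exact absurd (hz h) (n1 i)
        · exact absurd h.symm (hwz _ _)
      · exact h
    · rintro rfl
      simp
  · intro i j hij hi hj
    ext u
    simp only [Finset.mem_inter, Finset.mem_insert, Finset.mem_singleton, Finset.notMem_empty,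
      iff_false, not_and]
    rintro (h | h | h) h'
    · subst h
      rcases h' with h | h | h
      · exact hij (hw h)
      · exact absurd h (hwz _ _)
      · exact hj (hw h).symm
    · subst h
      rcases h' with h | h | h
      · exact absurd h.symm (hwz _ _)
      · exact hij (hz h)
      · exact absurd h.symm (hwz _ _)
    · subst h
      rcases h' with h | h | h
      · exact hi (hw h)
      · exact absurd h (hwz _ _)
      · have := hw h
        simp at this
        exact hij this

/-- Closing a path of length at least two by an edge gives a linear cycle. -/
lemma LP.close (h3 : ∀ e ∈ E, e.card = 3) (hcyc : ¬ HasLinearCycle E) {x y t : V}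
    {U : Finset V} (h : LP E x y U) (hU : 5 ≤ U.card) (hr : HR E x y t) (ht : t ∉ U) : False := by
  obtain ⟨m, w, z, h0, hm, hc, he, hwU, hzU, hw, hzz, hwz⟩ := h.labels
  apply hcyc
  have hv : ∀ i : ZMod (m + 1), i.val ≤ m := fun i => Nat.lt_succ_iff.mp (ZMod.val_lt i)
  refine cycle_of_labels (k := m + 1) (by omega) (fun i => w i.val)
    (fun i => if i.val < m then z i.val else t) ?_ ?_ ?_ ?_
  · intro i j hij
    exact ZMod.val_injective _ (hw _ (hv i) _ (hv j) hij)
  · intro i j hij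
    apply ZMod.val_injective
    have hi := hv i
    have hj := hv j
    dsimp only at hij
    split_ifs at hij with a b b
    · exact hzz _ a _ b hij
    · exact absurd (hzU _ a) (hij ▸ ht)
    · exact absurd (hzU _ b) (hij ▸ ht)
    · omega
  · intro i j
    split_ifs with a
    · exact hwz _ (hv i) _ a
    · intro h
      exact ht (h ▸ hwU _ (hv i))
  · intro i
    split_ifs with a
    · have : (i + 1).val = i.val + 1 := by
        have : Fact (1 < m + 1) := ⟨by omega⟩
        rw [ZMod.val_add, ZMod.val_one, Nat.mod_eq_of_lt (by omega)]
      rw [this]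
      exact he _ a
    · have hi := hv i
      have him : i.val = m := by omega
      have : i + 1 = 0 := by
        have : i = ((m : ℕ) : ZMod (m + 1)) := by
          have := ZMod.natCast_zmod_val i
          rw [him] at this
          exact this.symm
        rw [this]
        have := ZMod.natCast_self (m + 1)
        push_cast at this
        exact this
      rw [this, him, ZMod.val_zero, h0, hm]
      exact hr.rot

/-- First hit of a pair with a path. -/
lemma LP.hit {x y : V} {U : Finset V} (h3 : ∀ e ∈ E, e.card = 3) (h : LP E x y U) {s t : V}
    (hst : s ≠ t)
    (hxs : x ≠ s) (hxt : x ≠ t) (hU : s ∈ U ∨ t ∈ U) :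
    ∃ s' t', (s' = s ∧ t' = t ∨ s' = t ∧ t' = s) ∧
      ((∃ U' ⊆ U, LP E x s' U' ∧ t' ∉ U') ∨
       (∃ x' U' U'', U' ⊆ U ∧ U'' ⊆ U ∧ Disjoint U' U'' ∧ LP E x x' U' ∧ LP E s' y U'' ∧
          HR E x' s' t' ∧ s' ∉ U' ∧ t' ∉ U' ∧ t' ∉ U'' ∧ t' ∈ U)) := by
  induction h with
  | nil x => grind
  | cons x z x' y U hr hx hz hxz hp ih =>
    have n := hr.ne h3
    have hx'U := hp.left_mem
    by_cases h1 : x' = s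
    · subst h1
      refine ⟨x', t, Or.inl ⟨rfl, rfl⟩, ?_⟩
      by_cases h2 : z = t
      · subst h2
        right
        exact ⟨x, {x}, U, by simp, by grind, by simpa using hx, LP.nil x, hp,
          hr.swap', by simpa using Ne.symm hxs, by simpa using Ne.symm hxz, hz, by simp⟩
      · left
        refine ⟨{x, z, x'}, by grind, LP.single h3 hr, ?_⟩
        grind
    by_cases h1' : x' = t
    · subst h1'
      refine ⟨x', s, Or.inr ⟨rfl, rfl⟩, ?_⟩
      by_cases h2 : z = s
      · subst h2
        right
        exact ⟨x, {x}, U, by simp, by grind, by simpa using hx, LP.nil x, hp,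
          hr.swap', by simpa using Ne.symm hxt, by simpa using Ne.symm hxz, hz, by simp⟩
      · left
        refine ⟨{x, z, x'}, by grind, LP.single h3 hr, ?_⟩
        grind
    by_cases h2 : z = s
    · subst h2
      refine ⟨z, t, Or.inl ⟨rfl, rfl⟩, Or.inl ⟨{x, x', z}, ?_, LP.single h3 hr.swap', ?_⟩⟩
      · grind
      · grind
    by_cases h2' : z = t
    · subst h2'
      refine ⟨z, s, Or.inr ⟨rfl, rfl⟩, Or.inl ⟨{x, x', z}, ?_, LP.single h3 hr.swap', ?_⟩⟩
      · grind
      · grind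
    have hU' : s ∈ U ∨ t ∈ U := by
      grind
    obtain ⟨s', t', hs', hh⟩ := ih h1 h1' hU'
    have hxs' : x ≠ s' ∧ x ≠ t' ∧ z ≠ s' ∧ z ≠ t' := by
      rcases hs' with ⟨rfl, rfl⟩ | ⟨rfl, rfl⟩ <;> grind
    refine ⟨s', t', hs', ?_⟩
    rcases hh with ⟨U', hU', hp', ht'⟩ | ⟨a, U', U'', hU', hU'', hd, hp1, hp2, hr', b1, b2, b3, b4⟩
    · left
      refine ⟨insert x (insert z U'), ?_, LP.front h3 hr (fun h => hx (hU' h))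
        (fun h => hz (hU' h)) hp', ?_⟩
      · exact Finset.insert_subset_insert _ (Finset.insert_subset_insert _ hU')
      · grind
    · right
      refine ⟨a, insert x (insert z U'), U'', ?_, ?_, ?_, LP.front h3 hr (fun h => hx (hU' h))
        (fun h => hz (hU' h)) hp1, hp2, hr', ?_, ?_, b3, by simp [b4]⟩
      · exact Finset.insert_subset_insert _ (Finset.insert_subset_insert _ hU')
      · exact hU''.trans (by grind)
      · rw [Finset.disjoint_insert_left, Finset.disjoint_insert_left]
        exact ⟨fun h => hx (hU'' h), fun h => hz (hU'' h), hd⟩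
      · grind
      · grind

lemma LP.card3 {x y : V} {U : Finset V} (h : LP E x y U) (hxy : x ≠ y) : 3 ≤ U.card := by
  obtain ⟨m, w, z, h0, hm, hc, -⟩ := h.labels
  have : m ≠ 0 := by
    rintro rfl
    exact hxy (h0.symm.trans hm)
  omega

/-- First edge of a nontrivial path. -/
lemma LP.first {x y : V} {U : Finset V} (h : LP E x y U) (hxy : x ≠ y) :
    ∃ z x' U', HR E x z x' ∧ x ∉ U' ∧ z ∉ U' ∧ x ≠ z ∧ LP E x' y U' ∧
      U = insert x (insert z U') := by
  cases h with
  | nil => exact absurd rfl hxy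
  | cons _ z x' _ U' a b c d e => exact ⟨z, x', U', a, b, c, d, e, rfl⟩

/-- Joining two nontrivial paths and closing them up. -/
lemma LP.close2 (h3 : ∀ e ∈ E, e.card = 3) (hcyc : ¬ HasLinearCycle E) {x q y t : V}
    {U W : Finset V} (h : LP E q x U) (h' : LP E q y W) (hx : q ≠ x) (hy : q ≠ y)
    (hd : ∀ u ∈ U, u ∈ W → u = q) (hr : HR E x y t) (ht : t ∉ U) (ht' : t ∉ W) : False := by
  have h1 := (h.reverse h3).append h' hd
  refine h1.close h3 hcyc ?_ hr (by simp [ht, ht'])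
  have c1 := h.card3 hx
  have c2 := h'.card3 hy
  have c3 : (U ∩ W).card ≤ 1 := by
    apply Finset.card_le_one.mpr
    intro a ha b hb
    simp at ha hb
    rw [hd a ha.1 ha.2, hd b hb.1 hb.2]
  have := Finset.card_union_add_card_inter U W
  omega

/-- Three edges forming a triangle. -/
lemma no_tri (h3 : ∀ e ∈ E, e.card = 3) (hcyc : ¬ HasLinearCycle E) {a b c x y z : V}
    (h1 : HR E a b x) (h2 : HR E b c y) (h4 : HR E a c z)
    (hxy : x ≠ y) (hxz : x ≠ z) (hyz : y ≠ z) (hxc : x ≠ c) (hya : y ≠ a) (hzb : z ≠ b) :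
    False := by
  have n1 := h1.ne h3
  have n2 := h2.ne h3
  have n4 := h4.ne h3
  refine LP.close2 h3 hcyc (q := b) (LP.single h3 h1.rot) (LP.single h3 h2.swap') n1.1.symm n2.1
    ?_ h4 ?_ ?_
  · grind
  · grind
  · grind

lemma tri_rot (a b c : V) : ({a, b, c} : Finset V) = {b, c, a} := by
  ext; simp; tauto

lemma tri_swap (a b c : V) : ({a, b, c} : Finset V) = {a, c, b} := by
  ext; simp; tauto

set_option maxHeartbeats 1000000 in
/-- The hanging lemma. -/
lemma hang (h3 : ∀ e ∈ E, e.card = 3) (hcyc : ¬ HasLinearCycle E) {y : V} (hg : HGad E y)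
    (hmin : ∀ F ⊂ E, F.Nonempty → ∀ q, ¬ HGad F q) {C : Finset V} {q : V} (hy : y ∈ C)
    (H : ∀ z U s t, LP E q z U → (∀ u ∈ U, u ∈ C → u = q) → z ≠ q → HR E z s t → s ∈ C →
      s ≠ q → t ≠ q → s ∉ U → t ∉ U → False)
    (hq : q ∈ C) {a0 b0 c0 : V} (h0 : HR E a0 b0 c0) (ha0 : a0 ∈ C) (hb0 : b0 ∈ C)
    {s t : V} (hr : HR E q s t) (hs : s ∉ C) (ht : t ∉ C) : False := by
  classical
  let Q : Finset V → Prop := fun e => ∃ x z w U, e = {x, z, w} ∧ LP E q x U ∧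
    (∀ u ∈ U, u ∈ C → u = q) ∧ z ∉ U ∧ w ∉ U ∧ z ∉ C ∧ w ∉ C
  have n0 := h0.ne h3
  have nr := hr.ne h3
  refine hmin (E.filter Q) ?_ ⟨{q, s, t}, ?_⟩ q ?_
  · refine (Finset.ssubset_iff_of_subset (Finset.filter_subset _ _)).mpr ⟨_, h0, ?_⟩
    intro hmem
    obtain ⟨x, z, w, U, he, -, -, -, -, hz, hw⟩ := (Finset.mem_filter.mp hmem).2
    have ha : a0 ∈ ({x, z, w} : Finset V) := by rw [← he]; simp
    have hb : b0 ∈ ({x, z, w} : Finset V) := by rw [← he]; simp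
    simp at ha hb
    grind
  · refine Finset.mem_filter.mpr ⟨hr, q, s, t, {q}, rfl, LP.nil q, by simp, ?_, ?_, hs, ht⟩
    · simpa using nr.1.symm
    · simpa using nr.2.1.symm
  · have aux : ∀ x z w U, HR E x z w → LP E q x U → (∀ u ∈ U, u ∈ C → u = q) → z ∉ U → w ∉ U →
        z ∉ C → w ∉ C → ∃ f ∈ E.filter Q, f ∩ {x, z, w} = {z} := by
      intro x z w U hxzw hp hU hzU hwU hzC hwC
      have hxU := hp.right_mem
      have hqU := hp.left_mem
      have n := hxzw.ne h3
      have hzy : z ≠ y := fun h => hzC (h ▸ hy)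
      have hzq : z ≠ q := fun h => hzC (h ▸ hq)
      obtain ⟨s, t, hf, hsx, hsw, htx, htw⟩ := hg.ex h3 hxzw.swap hzy
      have nf := hf.ne h3
      have hinter : ({z, s, t} : Finset V) ∩ {x, z, w} = {z} := by
        ext u
        simp only [Finset.mem_inter, Finset.mem_insert, Finset.mem_singleton]
        grind
      refine ⟨{z, s, t}, Finset.mem_filter.mpr ⟨hf, ?_⟩, hinter⟩
      by_cases hT : s ∈ U ∨ t ∈ U
      · obtain ⟨s', t', hs', hh⟩ := (hp.reverse h3).hit h3 nf.2.2 hsx.symm htx.symm hT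
        have hf' : HR E z s' t' := by
          rcases hs' with ⟨rfl, rfl⟩ | ⟨rfl, rfl⟩
          · exact hf
          · exact hf.swap'
        have nf' := hf'.ne h3
        have hx' : s' ≠ x ∧ s' ≠ w ∧ t' ≠ x ∧ t' ≠ w := by
          rcases hs' with ⟨rfl, rfl⟩ | ⟨rfl, rfl⟩ <;> exact ⟨by assumption, by assumption, by assumption, by assumption⟩
        rcases hh with ⟨U', hU', hp', ht'⟩ | ⟨a, U', U'', hU', hU'', hd, hp1, hp2, hr', b1, b2, b3, b4⟩
        · exfalso
          refine LP.close2 h3 hcyc (LP.single h3 hxzw.swap') hp' n.1 hx'.1.symm ?_ hf' ?_ ht'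
          · intro u hu hu'
            have := hU' hu'
            grind
          · grind
        · refine ⟨s', t', z, U'', ?_, hp2.reverse h3, fun u hu => hU u (hU'' hu), b3,
            fun h => hzU (hU'' h), ?_, hzC⟩
          · rcases hs' with ⟨rfl, rfl⟩ | ⟨rfl, rfl⟩
            · exact tri_rot _ _ _
            · rw [tri_swap, tri_rot]
          · intro h
            have h1 := hU _ b4 h
            exact b3 (h1 ▸ hp2.right_mem)
      · push Not at hT
        have hp2 : LP E q z (U ∪ {x, w, z}) := hp.append (LP.single h3 hxzw.swap') (by grind)
        have hU2 : ∀ u ∈ U ∪ {x, w, z}, u ∈ C → u = q := by grind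
        have hs2 : s ∉ U ∪ {x, w, z} := by grind
        have ht2 : t ∉ U ∪ {x, w, z} := by grind
        have hsq : s ≠ q := fun h => hT.1 (h ▸ hqU)
        have htq : t ≠ q := fun h => hT.2 (h ▸ hqU)
        by_cases hsC : s ∈ C
        · exact (H z _ s t hp2 hU2 hzq hf hsC hsq htq hs2 ht2).elim
        by_cases htC : t ∈ C
        · exact (H z _ t s hp2 hU2 hzq hf.swap' htC htq hsq ht2 hs2).elim
        exact ⟨z, s, t, _, rfl, hp2, hU2, hs2, ht2, hsC, htC⟩
    intro e he u hu huq
    obtain ⟨heE, x, z, w, U, rfl, hp, hU, hz, hw, hzC, hwC⟩ := Finset.mem_filter.mp he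
    have heE' : HR E x z w := heE
    simp at hu
    rcases hu with rfl | rfl | rfl
    · obtain ⟨z', x', U', r1, r2, r3, r4, r5, rfl⟩ := (hp.reverse h3).first huq
      have m1 := r5.left_mem
      have m2 := r5.right_mem
      have n1 := r1.ne h3
      refine ⟨{u, z', x'}, Finset.mem_filter.mpr ⟨r1, x', z', u, U', ?_, r5.reverse h3, ?_, r3, r2,
        ?_, ?_⟩, ?_⟩
      · rw [tri_swap, tri_rot, tri_rot]
      · intro v hv; exact hU v (by simp [hv])
      · intro h
        have := hU z' (by simp) h
        exact r3 (this ▸ m2)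
      · intro h
        exact huq (hU u (by simp) h)
      · ext v
        simp only [Finset.mem_inter, Finset.mem_insert, Finset.mem_singleton]
        grind
    · exact aux x u w U heE' hp hU hz hw hzC hwC
    · have h1 := aux x u z U heE'.swap' hp hU hw hz hwC hzC
      have h2 : ({x, u, z} : Finset V) = {x, z, u} := tri_swap _ _ _
      rwa [h2] at h1

/-- Every vertex of a path can be reached inside the path. -/
lemma LP.reach (h3 : ∀ e ∈ E, e.card = 3) {x y : V} {U : Finset V} (h : LP E x y U) {v : V}
    (hv : v ∈ U) : ∃ U' ⊆ U, LP E x v U' := by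
  induction h with
  | nil x =>
    simp at hv
    subst hv
    exact ⟨{v}, subset_rfl, LP.nil v⟩
  | cons x z x' y U hr hx hz hxz hp ih =>
    simp at hv
    rcases hv with rfl | rfl | hv
    · exact ⟨{v}, by simp, LP.nil v⟩
    · have := hp.left_mem
      exact ⟨{x, x', v}, by grind, LP.single h3 hr.swap'⟩
    · obtain ⟨U', h1, h2⟩ := ih hv
      exact ⟨insert x (insert z U'), by grind, LP.cons x z x' v U' hr (fun h => hx (h1 h))
        (fun h => hz (h1 h)) hxz h2⟩

/-- Robustness of `C` at `q`. -/
def Rob (E : Finset (Finset V)) (C : Finset V) (q : V) : Prop :=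
  ∀ s t, s ∈ C → s ≠ q → t ≠ q → s ≠ t → ∃ U ⊆ C, (LP E q s U ∧ t ∉ U) ∨ (LP E q t U ∧ s ∉ U)

lemma Rob.no (h3 : ∀ e ∈ E, e.card = 3) (hcyc : ¬ HasLinearCycle E) {y : V} (hg : HGad E y)
    (hmin : ∀ F ⊂ E, F.Nonempty → ∀ q, ¬ HGad F q) {C : Finset V} {q : V} (hR : Rob E C q)
    (hy : y ∈ C) (hq : q ∈ C) {a0 b0 c0 : V} (h0 : HR E a0 b0 c0) (ha0 : a0 ∈ C) (hb0 : b0 ∈ C)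
    {s t : V} (hr : HR E q s t) : s ∈ C ∨ t ∈ C := by
  by_contra hcon
  push Not at hcon
  refine hang h3 hcyc hg hmin hy ?_ hq h0 ha0 hb0 hr hcon.1 hcon.2
  intro z U s1 t1 hp hU hzq hr1 hs1 hs1q ht1q hs1U ht1U
  obtain ⟨W, hW, h | h⟩ := hR s1 t1 hs1 hs1q ht1q (hr1.ne h3).2.2
  · exact hp.close2 h3 hcyc h.1 hzq.symm hs1q.symm (fun u hu hu' => hU u hu (hW hu')) hr1 ht1U h.2
  · exact hp.close2 h3 hcyc h.1 hzq.symm ht1q.symm (fun u hu hu' => hU u hu (hW hu')) hr1.swap'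
      hs1U h.2

/-- Lollipops ending in `y`. -/
def Lol (E : Finset (Finset V)) (y s t a d : V) (A W : Finset V) : Prop :=
  LP E s y A ∧ LP E a d W ∧ a ≠ d ∧ HR E a s t ∧ HR E d s t ∧ Disjoint W A ∧ t ∉ W ∧ t ∉ A

lemma Lol.exists [Fintype V] (h3 : ∀ e ∈ E, e.card = 3) (hcyc : ¬ HasLinearCycle E) {y : V}
    (hg : HGad E y) (n : ℕ) : ∀ U c a b, LP E y c U → HR E c a b → a ∉ U → b ∉ U →
      Fintype.card V - U.card = n → ∃ s t a d A W, Lol E y s t a d A W := by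
  induction n using Nat.strong_induction_on with
  | _ n ih =>
    intro U c a b hp hr ha hb hn
    have hyU := hp.left_mem
    have hcU := hp.right_mem
    have nr := hr.ne h3
    have hay : a ≠ y := fun h => ha (h ▸ hyU)
    obtain ⟨s, t, hf, hsb, hsc, htb, htc⟩ := hg.ex h3 hr.rot hay
    have nf := hf.ne h3
    by_cases hT : s ∈ U ∨ t ∈ U
    · obtain ⟨s', t', hs', hh⟩ := (hp.reverse h3).hit h3 nf.2.2 hsc.symm htc.symm hT
      have hf' : HR E a s' t' ∧ s' ≠ b ∧ s' ≠ c ∧ t' ≠ b ∧ t' ≠ c := by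
        rcases hs' with ⟨rfl, rfl⟩ | ⟨rfl, rfl⟩
        · exact ⟨hf, hsb, hsc, htb, htc⟩
        · exact ⟨hf.swap', htb, htc, hsb, hsc⟩
      obtain ⟨hf', k1, k2, k3, k4⟩ := hf'
      have nf' := hf'.ne h3
      rcases hh with ⟨U', hU', hp', ht'⟩ |
        ⟨x', U', U'', hU', hU'', hd, hp1, hp2, hr', b1, b2, b3, b4⟩
      · exfalso
        refine LP.close2 h3 hcyc (LP.single h3 hr.swap') hp' nr.1 k2.symm ?_ hf' ?_ ht'
        · intro u hu hu'
          have := hU' hu'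
          grind
        · grind
      · refine ⟨s', t', a, x', U'', insert a (insert b U'), hp2, ?_, ?_, hf', hr', ?_, ?_, b3⟩
        · exact LP.front h3 hr.rot (fun h => ha (hU' h)) (fun h => hb (hU' h)) hp1
        · rintro rfl
          exact ha (hU' hp1.right_mem)
        · rw [Finset.disjoint_left] at hd ⊢
          intro u hu hu'
          simp at hu
          rcases hu with rfl | rfl | hu
          · exact ha (hU'' hu')
          · exact hb (hU'' hu')
          · exact hd hu hu'
        · grind
    · push Not at hT
      have hp2 : LP E y a (U ∪ {c, b, a}) := hp.append (LP.single h3 hr.swap') (by grind)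
      refine ih (Fintype.card V - (U ∪ {c, b, a}).card) ?_ _ a s t hp2 hf ?_ ?_ rfl
      · have h1 : U.card < (U ∪ {c, b, a}).card := by
          apply Finset.card_lt_card
          refine (Finset.ssubset_iff_of_subset Finset.subset_union_left).mpr ⟨a, by simp, ha⟩
        have h2 := Finset.card_le_univ (U ∪ {c, b, a})
        omega
      · grind
      · grind

lemma Lol.root (h3 : ∀ e ∈ E, e.card = 3) (hcyc : ¬ HasLinearCycle E) {y : V} (hg : HGad E y)
    (hmin : ∀ F ⊂ E, F.Nonempty → ∀ q, ¬ HGad F q) (n : ℕ) :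
    ∀ s t a d A W, Lol E y s t a d A W → A.card = n → ∃ t a d A W, Lol E y y t a d A W := by
  induction n using Nat.strong_induction_on with
  | _ n ih =>
    intro s t a d A W hl hn
    by_cases hsy : s = y
    · subst hsy
      exact ⟨t, a, d, A, W, hl⟩
    obtain ⟨l1, l2, l3, l4, l5, l6, l7, l8⟩ := hl
    by_contra hcon
    obtain ⟨z, x', U', e1, -, -, -, -, rfl⟩ := l1.first hsy
    refine hang h3 hcyc hg hmin l1.right_mem ?_ l1.left_mem e1 (by simp) (by simp) l4.swap ?_ l8
    · intro z1 U s1 t1 hp hU hz hr hs1 hs1s ht1s hs1U ht1U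
      have nr := hr.ne h3
      obtain ⟨s', t', hs', hh⟩ := l1.hit h3 nr.2.2 hs1s.symm ht1s.symm (Or.inl hs1)
      have hr' : HR E z1 s' t' ∧ s' ≠ s ∧ t' ∉ U := by
        rcases hs' with ⟨rfl, rfl⟩ | ⟨rfl, rfl⟩
        · exact ⟨hr, hs1s, ht1U⟩
        · exact ⟨hr.swap', ht1s, hs1U⟩
      obtain ⟨hr', k1, k2⟩ := hr'
      rcases hh with ⟨V', hV', hp', ht'⟩ |
        ⟨x', V', V'', hV', hV'', hd, hp1, hp2, hr'', b1, b2, b3, b4⟩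
      · exact hp.close2 h3 hcyc hp' hz.symm k1.symm (fun u hu hu' => hU u hu (hV' hu')) hr' k2 ht'
      · have hsV := hp1.left_mem
        rw [Finset.disjoint_left] at hd
        apply hcon
        refine ih V''.card ?_ s' t' z1 x' V'' (U ∪ V')
          ⟨hp2, (hp.reverse h3).append hp1 (fun u hu hu' => hU u hu (hV' hu')), ?_, hr', hr'', ?_,
            by simp [k2, b2], b3⟩ rfl
        · rw [← hn]
          apply Finset.card_lt_card
          exact (Finset.ssubset_iff_of_subset hV'').mpr ⟨s, by simp, hd hsV⟩
        · rintro rfl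
          exact hz (hU _ hp.right_mem (hV' hp1.right_mem))
        · rw [Finset.disjoint_left]
          intro u hu hu'
          rcases Finset.mem_union.mp hu with hu | hu
          · have := hU u hu (hV'' hu')
            subst this
            exact hd hsV hu'
          · exact hd hu hu'
    · exact Finset.disjoint_left.mp l6 l2.left_mem


lemma rob_cycle (h3 : ∀ e ∈ E, e.card = 3) {p q a d : V} {W : Finset V} (ha : HR E a p q)
    (hd : HR E d p q) (hW : LP E a d W) (had : a ≠ d) (hp : p ∉ W) (hq : q ∉ W) :
    Rob E (insert p (insert q W)) q := by
  have haW := hW.left_mem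
  have hdW := hW.right_mem
  have na := ha.ne h3
  have nd := hd.ne h3
  have key : ∀ t, t ≠ q → t ≠ p → ∃ U ⊆ insert p (insert q W), LP E q p U ∧ t ∉ U := by
    intro t ht ht'
    by_cases hta : t = a
    · exact ⟨{q, d, p}, by grind, LP.single h3 hd.rot.rot, by grind⟩
    · exact ⟨{q, a, p}, by grind, LP.single h3 ha.rot.rot, by grind⟩
  intro s t hs hsq htq hst
  by_cases hsp : s = p
  · subst hsp
    obtain ⟨U, hU, h⟩ := key t htq hst.symm
    exact ⟨U, hU, Or.inl h⟩
  by_cases htp : t = p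
  · subst htp
    obtain ⟨U, hU, h⟩ := key s hsq hst
    exact ⟨U, hU, Or.inr h⟩
  have hsW : s ∈ W := by grind
  by_cases hsa : s = a
  · subst hsa
    exact ⟨{q, p, s}, by grind, Or.inl ⟨LP.single h3 ha.rot.rot.swap', by grind⟩⟩
  by_cases hta : t = a
  · subst hta
    exact ⟨{q, p, t}, by grind, Or.inr ⟨LP.single h3 ha.rot.rot.swap', by grind⟩⟩
  obtain ⟨s', t', hs', hh⟩ := hW.hit h3 hst (Ne.symm hsa) (Ne.symm hta) (Or.inl hsW)
  have k : t' ≠ p ∧ t' ≠ q := by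
    rcases hs' with ⟨rfl, rfl⟩ | ⟨rfl, rfl⟩
    · exact ⟨htp, htq⟩
    · exact ⟨hsp, hsq⟩
  have fin : ∃ U ⊆ insert p (insert q W), LP E q s' U ∧ t' ∉ U := by
    rcases hh with ⟨U', hU', hp', ht'⟩ |
        ⟨x', U', U'', hU', hU'', -, hp1, hp2, hr', b1, b2, b3, b4⟩
    · exact ⟨insert q (insert p U'), by grind, LP.front h3 ha.rot.rot.swap' (fun h => hq (hU' h))
        (fun h => hp (hU' h)) hp', by grind⟩
    · exact ⟨insert q (insert p U''), by grind, LP.front h3 hd.rot.rot.swap' (fun h => hq (hU'' h))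
        (fun h => hp (hU'' h)) (hp2.reverse h3), by grind⟩
  obtain ⟨U, hU, h⟩ := fin
  rcases hs' with ⟨rfl, rfl⟩ | ⟨rfl, rfl⟩
  · exact ⟨U, hU, Or.inl h⟩
  · exact ⟨U, hU, Or.inr h⟩

lemma step4 (h3 : ∀ e ∈ E, e.card = 3) (hcyc : ¬ HasLinearCycle E) {y : V} (hg : HGad E y)
    (hmin : ∀ F ⊂ E, F.Nonempty → ∀ q, ¬ HGad F q) {q a b c d : V} {U : Finset V}
    (ha : HR E a y q) (hd : HR E d y q) (had : a ≠ d) (hab : HR E a b c) (hU : LP E c d U)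
    (haU : a ∉ U) (hbU : b ∉ U) (hyU : y ∉ U) (hqU : q ∉ U) (hyb : y ≠ b) (hqb : q ≠ b) :
    HR E q a b := by
  have na := ha.ne h3
  have nd := hd.ne h3
  have nab := hab.ne h3
  have hcU := hU.left_mem
  have hdU := hU.right_mem
  have hW : LP E a d (insert a (insert b U)) := LP.front h3 hab haU hbU hU
  have hyW : y ∉ insert a (insert b U) := by grind
  have hqW : q ∉ insert a (insert b U) := by grind
  have hR := rob_cycle h3 ha hd hW had hyW hqW
  obtain ⟨s, t, hr, hsy, hsd, hty, htd⟩ := hg.ex h3 hd.rot.rot.swap' na.2.2.symm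
  have hin := hR.no h3 hcyc hg hmin (by simp) (by simp) hd.rot (by simp) (by simp) hr
  have nr := hr.ne h3
  have hdq : LP E d q {d, y, q} := LP.single h3 hd
  -- exactly one vertex in `U`
  have K1 : ∀ v t, HR E q v t → v ≠ d → t ≠ y → t ≠ d → v ∈ U → t ∉ U → False := by
    intro v t hr hvd hty htd hv ht
    have nr := hr.ne h3
    obtain ⟨U', hU', hp⟩ := (hU.reverse h3).reach h3 hv
    exact hdq.close2 h3 hcyc hp nd.2.1 hvd.symm (by grind) hr (by grind) (fun h => ht (hU' h))
  by_cases hs : s ∈ U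
  · by_cases ht : t ∈ U
    · exfalso
      obtain ⟨s', t', hs', hh⟩ := (hU.reverse h3).hit h3 nr.2.2 hsd.symm htd.symm (Or.inl hs)
      have k : HR E q s' t' ∧ s' ≠ d ∧ t' ≠ d ∧ t' ≠ y ∧ s' ∈ U ∧ t' ∈ U := by
        rcases hs' with ⟨rfl, rfl⟩ | ⟨rfl, rfl⟩
        · exact ⟨hr, hsd, htd, hty, hs, ht⟩
        · exact ⟨hr.swap', htd, hsd, hsy, ht, hs⟩
      obtain ⟨hr', k1, k2, k3, k4, k5⟩ := k
      have nr' := hr'.ne h3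
      rcases hh with ⟨U', hU', hp', ht'⟩ |
        ⟨x', U', U'', hU', hU'', -, hp1, hp2, -, b1, b2, b3, b4⟩
      · exact hdq.close2 h3 hcyc hp' nd.2.1 k1.symm (by grind) hr' (by grind) ht'
      · have hp3 : LP E a s' (insert a (insert b U'')) :=
          LP.front h3 hab (fun h => haU (hU'' h)) (fun h => hbU (hU'' h)) (hp2.reverse h3)
        exact (LP.single h3 ha).close2 h3 hcyc hp3 na.2.1 (by grind) (by grind) hr' (by grind)
          (by grind)
    · exact (K1 s t hr hsd hty htd hs ht).elim
  by_cases ht : t ∈ U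
  · exact (K1 t s hr.swap' htd hsy hsd ht hs).elim
  have K2 : ∀ t, HR E q a t → t ≠ y → t ≠ d → t ∉ U → t = b := by
    intro t hr hty htd ht
    by_contra htb
    have nr := hr.ne h3
    exact hdq.close2 h3 hcyc (hW.reverse h3) nd.2.1 had.symm (by grind) hr (by grind) (by grind)
  have K3 : ∀ t, HR E q b t → t ≠ y → t ≠ d → t ∉ U → t = a := by
    intro t hr hty htd ht
    by_contra htb
    have nr := hr.ne h3
    have hp : LP E b d (insert b (insert a U)) := LP.front h3 hab.swap hbU haU hU
    exact hdq.close2 h3 hcyc (hp.reverse h3) nd.2.1 (by grind) (by grind) hr (by grind) (by grind)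
  have hcase : s = a ∨ s = b ∨ t = a ∨ t = b := by grind
  rcases hcase with rfl | rfl | rfl | rfl
  · have := K2 t hr hty htd ht
    subst this
    exact hr
  · have := K3 t hr hty htd ht
    subst this
    exact hr.swap'
  · have := K2 s hr.swap' hsy hsd hs
    subst this
    exact hr.swap'
  · have := K3 s hr.swap' hsy hsd hs
    subst this
    exact hr

lemma step5 (h3 : ∀ e ∈ E, e.card = 3) (hcyc : ¬ HasLinearCycle E) {y : V} (hg : HGad E y)
    (hmin : ∀ F ⊂ E, F.Nonempty → ∀ q, ¬ HGad F q) {q a b d : V}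
    (ha : HR E y q a) (hd : HR E y q d) (hb : HR E q a b) (had : a ≠ d) (hby : b ≠ y)
    (hbd : b ≠ d) : HR E a d y := by
  have na := ha.ne h3
  have nd := hd.ne h3
  have nb := hb.ne h3
  have hR : Rob E {y, q, a, b} a := by
    intro s t hs hsa hta hst
    have P1 : LP E a y {a, q, y} := LP.single h3 ha.rot.rot.swap'
    have P2 : LP E a q {a, b, q} := LP.single h3 hb.rot
    have P3 : LP E a q {a, y, q} := LP.single h3 ha.rot.rot
    have P4 : LP E a b {a, q, b} := LP.single h3 hb.swap
    simp at hs
    rcases hs with rfl | rfl | rfl | rfl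
    · by_cases htq : t = q
      · subst htq
        exact ⟨_, by grind, Or.inr ⟨P2, by grind⟩⟩
      · exact ⟨_, by grind, Or.inl ⟨P1, by grind⟩⟩
    · by_cases hty : t = y
      · subst hty
        exact ⟨_, by grind, Or.inl ⟨P2, by grind⟩⟩
      · exact ⟨_, by grind, Or.inl ⟨P3, by grind⟩⟩
    · exact absurd rfl hsa
    · by_cases htq : t = q
      · subst htq
        exact ⟨_, by grind, Or.inr ⟨P3, by grind⟩⟩
      · exact ⟨_, by grind, Or.inl ⟨P4, by grind⟩⟩
  obtain ⟨s, t, hr, hsq, hsb, htq, htb⟩ := hg.ex h3 hb.swap na.2.1.symm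
  have hin := hR.no h3 hcyc hg hmin (by simp) (by simp) ha (by simp) (by simp) hr
  have nr := hr.ne h3
  have fin : ∀ t, HR E a y t → t ≠ q → t ≠ b → HR E a d y := by
    intro t hr htq htb
    have nr := hr.ne h3
    by_cases htd : t = d
    · subst htd
      exact hr.swap'
    · exact (no_tri h3 hcyc hd hb hr.swap hbd.symm (Ne.symm htd) htb.symm had.symm hby htq).elim
  have hc : s = y ∨ t = y := by grind
  rcases hc with rfl | rfl
  · exact fin t hr htq htb
  · exact fin s hr.swap' hsq hsb

lemma stepM2 (h3 : ∀ e ∈ E, e.card = 3) (hcyc : ¬ HasLinearCycle E) {y : V} (hg : HGad E y)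
    (hmin : ∀ F ⊂ E, F.Nonempty → ∀ q, ¬ HGad F q) {q a b c : V} (h : HR E a b c)
    (ha : HR E y q a) (hc : HR E y q c) (hyb : y ≠ b) (hqb : q ≠ b) :
    HR E q a b ∧ HR E y a c := by
  have n := h.ne h3
  have na := ha.ne h3
  have nc := hc.ne h3
  have h1 : HR E q a b := step4 h3 hcyc hg hmin ha.rot.rot hc.rot.rot n.2.1 h (LP.nil c)
    (by grind) (by grind) (by grind) (by grind) hyb hqb
  exact ⟨h1, (step5 h3 hcyc hg hmin ha hc h1 n.2.1 hyb.symm n.2.2).rot.rot⟩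

lemma step6 (h3 : ∀ e ∈ E, e.card = 3) (hcyc : ¬ HasLinearCycle E) {y : V} (hg : HGad E y)
    (hmin : ∀ F ⊂ E, F.Nonempty → ∀ q, ¬ HGad F q) {q a b c : V} (h : HR E a b c)
    (ha : HR E y q a) (hc : HR E y q c) (hyb : y ≠ b) (hqb : q ≠ b) : HR E y q b := by
  have n := h.ne h3
  have na := ha.ne h3
  have nc := hc.ne h3
  have hqab := (stepM2 h3 hcyc hg hmin h ha hc hyb hqb).1
  have hqcb := (stepM2 h3 hcyc hg hmin h.rot.rot.swap' hc ha hyb hqb).1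
  have hR : Rob E {y, q, a, b, c} b := by
    have key : ∀ v w, v = a ∨ v = c ∨ v = q → w ≠ v → w ≠ b →
        ∃ U ⊆ ({y, q, a, b, c} : Finset V), LP E b v U ∧ w ∉ U := by
      have P1 : LP E b a {b, c, a} := LP.single h3 h.rot
      have P2 : LP E b a {b, q, a} := LP.single h3 hqab.rot.rot
      have P3 : LP E b c {b, a, c} := LP.single h3 h.swap
      have P4 : LP E b c {b, q, c} := LP.single h3 hqcb.rot.rot
      have P5 : LP E b q {b, a, q} := LP.single h3 hqab.rot.rot.swap'
      have P6 : LP E b q {b, c, q} := LP.single h3 hqcb.rot.rot.swap'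
      intro v w hv hwv hwb
      rcases hv with rfl | rfl | rfl
      · by_cases hw : w = c
        · exact ⟨_, by grind, P2, by grind⟩
        · exact ⟨_, by grind, P1, by grind⟩
      · by_cases hw : w = a
        · exact ⟨_, by grind, P4, by grind⟩
        · exact ⟨_, by grind, P3, by grind⟩
      · by_cases hw : w = a
        · exact ⟨_, by grind, P6, by grind⟩
        · exact ⟨_, by grind, P5, by grind⟩
    intro s t hs hsb htb hst
    by_cases h1 : s = a ∨ s = c ∨ s = q
    · obtain ⟨U, hU, hh⟩ := key s t h1 hst.symm htb
      exact ⟨U, hU, Or.inl hh⟩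
    by_cases h2 : t = a ∨ t = c ∨ t = q
    · obtain ⟨U, hU, hh⟩ := key t s h2 hst hsb
      exact ⟨U, hU, Or.inr hh⟩
    have hsy : s = y := by grind
    subst hsy
    have P : LP E b s (insert b (insert c {q, a, s})) :=
      LP.front h3 hqcb.rot.rot.swap' (by grind) (by grind) (LP.single h3 ha.rot)
    exact ⟨_, by grind, Or.inl ⟨P, by grind⟩⟩
  obtain ⟨s, t, hr, hsa, hsc, hta, htc⟩ := hg.ex h3 h.swap hyb.symm
  have hin := hR.no h3 hcyc hg hmin (by simp) (by simp) ha (by simp) (by simp) hr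
  have nr := hr.ne h3
  have F1 : ∀ t, HR E b y t → t ≠ a → t ≠ c → HR E y q b := by
    intro t hr hta htc
    have nr := hr.ne h3
    by_cases htq : t = q
    · subst htq
      exact hr.rot
    · exact (no_tri h3 hcyc hr ha.swap' h.swap htq htc (by grind) hta hqb (by grind)).elim
  have F2 : ∀ t, HR E b q t → t ≠ a → t ≠ c → HR E y q b := by
    intro t hr hta htc
    have nr := hr.ne h3
    by_cases hty : t = y
    · subst hty
      exact hr.rot.swap
    · exact (no_tri h3 hcyc hr ha.rot h.swap hty htc (by grind) hta hyb (by grind)).elim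
  have hcc : s = y ∨ t = y ∨ s = q ∨ t = q := by grind
  rcases hcc with rfl | rfl | rfl | rfl
  · exact F1 t hr hta htc
  · exact F1 s hr.swap' hsa hsc
  · exact F2 t hr hta htc
  · exact F2 s hr.swap' hsa hsc

lemma step7 (h3 : ∀ e ∈ E, e.card = 3) (hcyc : ¬ HasLinearCycle E) {y : V} (hg : HGad E y)
    (hmin : ∀ F ⊂ E, F.Nonempty → ∀ q, ¬ HGad F q) {q a b c : V} (h : HR E a b c)
    (ha : HR E y q a) (hc : HR E y q c) (hyb : y ≠ b) (hqb : q ≠ b) :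
    ∃ S : Finset V, S.card = 5 ∧ ∀ e ⊆ S, e.card = 3 → e ∈ E := by
  have n := h.ne h3
  have na := ha.ne h3
  have nc := hc.ne h3
  have hb := step6 h3 hcyc hg hmin h ha hc hyb hqb
  obtain ⟨qab, yac⟩ := stepM2 h3 hcyc hg hmin h ha hc hyb hqb
  obtain ⟨qcb, -⟩ := stepM2 h3 hcyc hg hmin h.rot.rot.swap' hc ha hyb hqb
  obtain ⟨qac, yab⟩ := stepM2 h3 hcyc hg hmin h.swap' ha hb nc.2.1 nc.2.2
  obtain ⟨-, ybc⟩ := stepM2 h3 hcyc hg hmin h.swap hb hc na.2.1 na.2.2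
  refine ⟨{y, q, a, b, c}, ?_, ?_⟩
  · rw [Finset.card_insert_of_notMem, Finset.card_insert_of_notMem, Finset.card_insert_of_notMem,
      Finset.card_insert_of_notMem, Finset.card_singleton]
    all_goals grind
  · intro e he hc3
    obtain ⟨u, v, w, huv, huw, hvw, rfl⟩ := Finset.card_eq_three.mp hc3
    have hu := he (show u ∈ _ by simp)
    have hv := he (show v ∈ _ by simp)
    have hw := he (show w ∈ _ by simp)
    simp only [Finset.mem_insert, Finset.mem_singleton] at hu hv hw
    clear he hc3
    change HR E u v w
    clear hg hmin
    rcases hu with hu | hu | hu | hu | hu <;> rcases hv with hv | hv | hv | hv | hv <;>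
      first
      | exact absurd (hu.trans hv.symm) huv
      | (rcases hw with hw | hw | hw | hw | hw <;>
          first
          | exact absurd (hu.trans hw.symm) huw
          | exact absurd (hv.trans hw.symm) hvw
          | (rw [hu, hv, hw]
             first
             | assumption
             | exact HR.swap (by assumption)
             | exact HR.swap' (by assumption)
             | exact HR.rot (by assumption)
             | exact HR.rot (HR.rot (by assumption))
             | exact HR.swap (HR.rot (by assumption))))

lemma HasLinearCycle.mono {F : Finset (Finset V)} (hF : F ⊆ E) (h : HasLinearCycle F) :
    HasLinearCycle E := by
  obtain ⟨k, v, h, h1, h2, h4, h5, h6⟩ := h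
  exact ⟨k, v, h, h1, h2, h4, fun i => hF (h5 i), h6⟩

/-- The main lemma: no nonempty hypergraph of our kind has the gadget property. -/
lemma not_HGad [Fintype V] (E : Finset (Finset V)) : (∀ e ∈ E, e.card = 3) → ¬ HasLinearCycle E →
    (¬ ∃ S : Finset V, S.card = 5 ∧ ∀ e ⊆ S, e.card = 3 → e ∈ E) → E.Nonempty →
    ∀ y, ¬ HGad E y := by
  induction E using Finset.strongInduction with
  | _ E ih =>
    intro h3 hcyc hK hne y0 hg0
    have hmin : ∀ F ⊂ E, F.Nonempty → ∀ q, ¬ HGad F q := by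
      intro F hF
      refine ih F hF (fun e he => h3 e (hF.1 he)) (fun h => hcyc (h.mono hF.1)) ?_
      rintro ⟨S, hS, hS'⟩
      exact hK ⟨S, hS, fun e he he' => hF.1 (hS' e he he')⟩
    have hroot : ∃ y, HGad E y ∧ ∃ a b, HR E y a b := by
      by_cases hy : ∃ e ∈ E, y0 ∈ e
      · obtain ⟨e, he, hye⟩ := hy
        obtain ⟨s, t, rfl⟩ := exists_HR h3 he hye
        exact ⟨y0, hg0, s, t, he⟩
      · obtain ⟨e, he⟩ := hne
        have : e.Nonempty := by
          rw [← Finset.card_pos, h3 e he]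
          norm_num
        obtain ⟨y, hye⟩ := this
        obtain ⟨s, t, rfl⟩ := exists_HR h3 he hye
        refine ⟨y, ?_, s, t, he⟩
        intro e' he' v hv _
        exact hg0 e' he' v hv (fun h => hy ⟨e', he', h ▸ hv⟩)
    obtain ⟨y, hg, a0, b0, hr0⟩ := hroot
    have n0 := hr0.ne h3
    obtain ⟨s, t, a, d, A, W, hl⟩ := Lol.exists h3 hcyc hg _ {y} y a0 b0 (LP.nil y) hr0
      (by simpa using n0.1.symm) (by simpa using n0.2.1.symm) rfl
    obtain ⟨q, a, d, A, W, l1, l2, had, ha, hd, l6, hqW, -⟩ :=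
      Lol.root h3 hcyc hg hmin _ s t a d A W hl rfl
    have hyW : y ∉ W := fun h => Finset.disjoint_left.mp l6 h l1.right_mem
    obtain ⟨b, c, U, hab, haU, hbU, -, hU, rfl⟩ := l2.first had
    have hqab := step4 h3 hcyc hg hmin ha hd had hab hU haU hbU (by grind) (by grind) (by grind)
      (by grind)
    have hdU := hU.right_mem
    have hady := step5 h3 hcyc hg hmin ha.rot hd.rot hqab had (by grind) (by grind)
    have hcd : c = d := by
      by_contra hcd
      refine l2.close h3 hcyc ?_ hady hyW
      have := hU.card3 hcd
      rw [Finset.card_insert_of_notMem (by simp [(hab.ne h3).1, haU]),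
        Finset.card_insert_of_notMem hbU]
      omega
    subst hcd
    exact hK (step7 h3 hcyc hg hmin hab ha.rot hd.rot (by grind) (by grind))

lemma two_color [Fintype V] (E : Finset (Finset V)) : (∀ e ∈ E, e.card = 3) →
    ¬ HasLinearCycle E →
    (¬ ∃ S : Finset V, S.card = 5 ∧ ∀ e ⊆ S, e.card = 3 → e ∈ E) →
    ∃ I : Finset V, (∀ e ∈ E, ¬ e ⊆ I) ∧ (∀ e ∈ E, ¬ e ⊆ Iᶜ) := by
  induction E using Finset.strongInduction with
  | _ E ih =>
    intro h3 hcyc hK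
    rcases E.eq_empty_or_nonempty with rfl | hne
    · exact ⟨∅, by simp, by simp⟩
    have hne' := hne
    obtain ⟨e0, he0⟩ := hne'
    have : e0.Nonempty := by
      rw [← Finset.card_pos, h3 e0 he0]
      norm_num
    obtain ⟨y, -⟩ := this
    have hn := not_HGad E h3 hcyc hK hne y
    unfold HGad at hn
    push Not at hn
    obtain ⟨e, he, v, hv, -, hf⟩ := hn
    have hss := Finset.erase_ssubset he
    obtain ⟨I, h1, h2⟩ := ih _ hss (fun e he => h3 e (hss.1 he)) (fun h => hcyc (h.mono hss.1)) (by
      rintro ⟨S, hS, hS'⟩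
      exact hK ⟨S, hS, fun e he he' => hss.1 (hS' e he he')⟩)
    have h3e := h3 e he
    obtain ⟨s, t, rfl⟩ := exists_HR h3 he hv
    have n := HR.ne h3 (show HR E v s t from he)
    have key : ∀ f ∈ E, v ∈ f → s ∈ f ∨ t ∈ f := by
      intro f hfE hvf
      by_contra hcon
      push Not at hcon
      apply hf f hfE
      ext u
      simp only [Finset.mem_inter, Finset.mem_insert, Finset.mem_singleton]
      grind
    have h1' : ∀ f ∈ E, f ≠ {v, s, t} → ∃ u ∈ f, u ∉ I := fun f hf hne =>
      Finset.not_subset.mp (h1 f (Finset.mem_erase.mpr ⟨hne, hf⟩))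
    have h2' : ∀ f ∈ E, f ≠ {v, s, t} → ∃ u ∈ f, u ∈ I := by
      intro f hf hne
      obtain ⟨u, hu, hu'⟩ := Finset.not_subset.mp (h2 f (Finset.mem_erase.mpr ⟨hne, hf⟩))
      exact ⟨u, hu, by simpa using hu'⟩
    suffices ∃ I : Finset V, (∀ e ∈ E, ∃ u ∈ e, u ∉ I) ∧ (∀ e ∈ E, ∃ u ∈ e, u ∈ I) by
      obtain ⟨I, g1, g2⟩ := this
      refine ⟨I, fun e he => Finset.not_subset.mpr (g1 e he), fun e he =>
        Finset.not_subset.mpr ?_⟩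
      obtain ⟨u, hu, hu'⟩ := g2 e he
      exact ⟨u, hu, by simpa using hu'⟩
    by_cases hI : v ∈ I ∧ s ∈ I ∧ t ∈ I
    · refine ⟨I.erase v, ?_, ?_⟩
      · intro f hf
        by_cases hfe : f = {v, s, t}
        · exact ⟨v, by simp [hfe], by simp⟩
        · obtain ⟨u, hu, hu'⟩ := h1' f hf hfe
          exact ⟨u, hu, by simp [hu']⟩
      · intro f hf
        by_cases hfe : f = {v, s, t}
        · exact ⟨s, by simp [hfe], by simp [hI.2.1, n.1.symm]⟩
        · obtain ⟨u, hu, hu'⟩ := h2' f hf hfe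
          by_cases huv : u = v
          · rcases key f hf (huv ▸ hu) with h | h
            · exact ⟨s, h, by simp [hI.2.1, n.1.symm]⟩
            · exact ⟨t, h, by simp [hI.2.2, n.2.1.symm]⟩
          · exact ⟨u, hu, by simp [hu', huv]⟩
    by_cases hJ : v ∉ I ∧ s ∉ I ∧ t ∉ I
    · refine ⟨insert v I, ?_, ?_⟩
      · intro f hf
        by_cases hfe : f = {v, s, t}
        · exact ⟨s, by simp [hfe], by simp [hJ.2.1, n.1.symm]⟩
        · obtain ⟨u, hu, hu'⟩ := h1' f hf hfe
          by_cases huv : u = v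
          · rcases key f hf (huv ▸ hu) with h | h
            · exact ⟨s, h, by simp [hJ.2.1, n.1.symm]⟩
            · exact ⟨t, h, by simp [hJ.2.2, n.2.1.symm]⟩
          · exact ⟨u, hu, by simp [hu', huv]⟩
      · intro f hf
        by_cases hfe : f = {v, s, t}
        · exact ⟨v, by simp [hfe], by simp⟩
        · obtain ⟨u, hu, hu'⟩ := h2' f hf hfe
          exact ⟨u, hu, by simp [hu']⟩
    · refine ⟨I, ?_, ?_⟩
      · intro f hf
        by_cases hfe : f = {v, s, t}
        · subst hfe
          by_contra hcon
          push Not at hcon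
          exact hI ⟨hcon v (by simp), hcon s (by simp), hcon t (by simp)⟩
        · exact h1' f hf hfe
      · intro f hf
        by_cases hfe : f = {v, s, t}
        · subst hfe
          by_contra hcon
          push Not at hcon
          exact hJ ⟨hcon v (by simp), hcon s (by simp), hcon t (by simp)⟩
        · exact h2' f hf hfe

end helpers

/-- A 3-uniform linear-cycle-free hypergraph on `n` vertices not containing `K₅³`
has an independent set of size at least `⌈n/2⌉`. -/
theorem independence_number_ge {V : Type*} [Fintype V] [DecidableEq V] (E : Finset (Finset V))
    (h3 : ∀ e ∈ E, e.card = 3) (hcyc : ¬ HasLinearCycle E)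
    (hK5 : ¬ ∃ S : Finset V, S.card = 5 ∧ ∀ e ⊆ S, e.card = 3 → e ∈ E) :
    ∃ I : Finset V, (∀ e ∈ E, ¬ e ⊆ I) ∧ (Fintype.card V + 1) / 2 ≤ I.card := by
  obtain ⟨I, h1, h2⟩ := two_color E h3 hcyc hK5
  have hc := Finset.card_add_card_compl I
  by_cases h : (Fintype.card V + 1) / 2 ≤ I.card
  · exact ⟨I, h1, h⟩
  · exact ⟨Iᶜ, h2, by omega⟩
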